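/- Let P(S,Y,T) be an ε-IP Blackwell optimal information structure with P(S=s,T=t)>0 for all s∈𝒮, t∈𝒯. Then there exist enumerations s₁,…,s_n of 𝒮 in decreasing order of P(Y=1|S=s) and t₁,…,t_k of 𝒯 in decreasing order of P(Y=1|T=t) such that: (i) the region A = {(i,j) : P(Y=1|S=s_i,T=t_j)=1} is upper-left, i.e. (i,j)∈A implies (i′,j′)∈A for all i′≤i and j′≤j; (ii) the region B = {(i,j)∈A : t_j∈T̃ and P(T=t_j|S=s_i)=H_{t_j}} is upper-left within the T̃-columns, i.e. (i,j)∈B implies (i′,j′)∈B for all i′≤i and all j′≤j with t_{j′}∈T̃; and (iii) the region C = {(i,j)∉A : t_j∈T̃ and P(T=t_j|S=s_i)=H_{t_j}} is lower-right within the T̃-columns, i.e. (i,j)∈C implies (i′,j′)∈C for all i′≥i and all j′≥j with t_{j′}∈T̃. -/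

import Mathlib

open Real
open scoped Classical

noncomputable section

namespace IPPaper

variable {S T : Type} [Fintype S] [Fintype T]

/-- Marginal probability of the secret `S`. -/
def pS (P : S → Bool → T → ℝ) (s : S) : ℝ := ∑ y, ∑ t, P s y t

/-- Marginal probability of the signal `T`. -/
def pT (P : S → Bool → T → ℝ) (t : T) : ℝ := ∑ s, ∑ y, P s y t

/-- Joint marginal on `(S,T)`. -/
def pST (P : S → Bool → T → ℝ) (s : S) (t : T) : ℝ := ∑ y, P s y t

/-- Joint marginal on `(Y,T)`. -/
def pYT (P : S → Bool → T → ℝ) (y : Bool) (t : T) : ℝ := ∑ s, P s y t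

/-- Joint marginal on `(S,Y)`. -/
def pSY (P : S → Bool → T → ℝ) (s : S) (y : Bool) : ℝ := ∑ t, P s y t

/-- An information structure: nonnegative, sums to one, every secret has positive
probability. -/
def InfoStructure (P : S → Bool → T → ℝ) : Prop :=
  (∀ s y t, 0 ≤ P s y t) ∧ (∑ s, ∑ y, ∑ t, P s y t) = 1 ∧ ∀ s, 0 < pS P s

/-- Conditional probability `P(T = t | S = s)`. -/
def condTS (P : S → Bool → T → ℝ) (t : T) (s : S) : ℝ := pST P s t / pS P s

/-- Conditional probability `P(S = s | T = t)`. -/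
def condST (P : S → Bool → T → ℝ) (s : S) (t : T) : ℝ := pST P s t / pT P t

/-- Posterior `P(Y = 1 | T = t)`. -/
def postYT (P : S → Bool → T → ℝ) (t : T) : ℝ := pYT P true t / pT P t

/-- Posterior `P(Y = 1 | S = s, T = t)`. -/
def postYST (P : S → Bool → T → ℝ) (s : S) (t : T) : ℝ := P s true t / pST P s t

/-- Prior conditional `P(Y = 1 | S = s)`. -/
def qS (P : S → Bool → T → ℝ) (s : S) : ℝ := pSY P s true / pS P s

/-- `ε`-inferential privacy. -/
def IsIP (ε : ℝ) (P : S → Bool → T → ℝ) : Prop :=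
  ∀ s₁ s₂ t, condTS P t s₁ ≤ Real.exp ε * condTS P t s₂

/-- Blackwell dominance via a row-stochastic garbling kernel. -/
def BlackwellDom {T₁ T₂ : Type} [Fintype T₁] [Fintype T₂]
    (Q₁ : Bool → T₁ → ℝ) (Q₂ : Bool → T₂ → ℝ) : Prop :=
  ∃ G : T₁ → T₂ → ℝ, (∀ a b, 0 ≤ G a b) ∧ (∀ a, ∑ b, G a b = 1) ∧
    ∀ y b, Q₂ y b = ∑ a, Q₁ y a * G a b

/-- `ε`-IP Blackwell optimality: no ε-IP information structure with the same
marginal on `(S,Y)` (over any finite signal set) strictly Blackwell dominates it. -/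
def BlackwellOptimal (ε : ℝ) (P : S → Bool → T → ℝ) : Prop :=
  InfoStructure P ∧ IsIP ε P ∧
  ¬ ∃ (n : ℕ) (P' : S → Bool → Fin n → ℝ),
      InfoStructure P' ∧ IsIP ε P' ∧ (∀ s y, pSY P' s y = pSY P s y) ∧
      BlackwellDom (pYT P') (pYT P) ∧ ¬ BlackwellDom (pYT P) (pYT P')

/-- Membership in `T̃`: signals with positive probability and nondegenerate posterior. -/
def inTildeT (P : S → Bool → T → ℝ) (t : T) : Prop :=
  0 < pT P t ∧ postYT P t ≠ 0 ∧ postYT P t ≠ 1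

/-- `L_t = min_s P(T=t|S=s)`. -/
def Lval [Nonempty S] (P : S → Bool → T → ℝ) (t : T) : ℝ :=
  Finset.univ.inf' Finset.univ_nonempty (fun s => condTS P t s)

/-- `H_t = max_s P(T=t|S=s)`. -/
def Hval [Nonempty S] (P : S → Bool → T → ℝ) (t : T) : ℝ :=
  Finset.univ.sup' Finset.univ_nonempty (fun s => condTS P t s)

/-- Expected utility `Σ_{t : P(T=t)>0} P(T=t)·u(P(Y=1|T=t))`. -/
def EU (P : S → Bool → T → ℝ) (u : ℝ → ℝ) : ℝ :=
  ∑ t ∈ Finset.univ.filter (fun t => 0 < pT P t), pT P t * u (postYT P t)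

end IPPaper

namespace IPPaper

open Filter Topology

section Auxiliary

set_option linter.unusedSectionVars false

variable {S T : Type} [Fintype S] [Fintype T]

/-! ### Marginals -/

lemma pS_eq_sum_pSY (P : S → Bool → T → ℝ) (s : S) : pS P s = ∑ y, pSY P s y := rfl

lemma pS_eq_sum_pST (P : S → Bool → T → ℝ) (s : S) : pS P s = ∑ t, pST P s t :=
  Finset.sum_comm

lemma pT_eq_sum_pST (P : S → Bool → T → ℝ) (t : T) : pT P t = ∑ s, pST P s t := rfl

lemma pST_eq_add (P : S → Bool → T → ℝ) (s : S) (y : Bool) (t : T) :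
    pST P s t = P s y t + P s (!y) t := by
  cases y <;> simp [pST, add_comm]

lemma pT_eq_add (P : S → Bool → T → ℝ) (y : Bool) (t : T) :
    pT P t = pYT P y t + pYT P (!y) t := by
  simp only [pT_eq_sum_pST, pST_eq_add P _ y, pYT, Finset.sum_add_distrib]

lemma pYT_nonneg {P : S → Bool → T → ℝ} (hP : ∀ s y t, 0 ≤ P s y t) (y : Bool) (t : T) :
    0 ≤ pYT P y t :=
  Finset.sum_nonneg fun s _ => hP s y t

lemma sum_condTS {P : S → Bool → T → ℝ} {s : S} (hs : 0 < pS P s) :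
    ∑ t, condTS P t s = 1 := by
  simp only [condTS, ← Finset.sum_div, ← pS_eq_sum_pST]
  exact div_self hs.ne'

lemma InfoStructure.of_pSY_eq {T' : Type} [Fintype T'] {P : S → Bool → T → ℝ}
    {P' : S → Bool → T' → ℝ} (hP : InfoStructure P) (hnn : ∀ s y t, 0 ≤ P' s y t)
    (hSY : ∀ s y, pSY P' s y = pSY P s y) : InfoStructure P' := by
  refine ⟨hnn, ?_, fun s => ?_⟩
  · exact (Finset.sum_congr rfl fun s _ => Finset.sum_congr rfl fun y _ => hSY s y).trans hP.2.1
  · rw [pS_eq_sum_pSY, Finset.sum_congr rfl fun y _ => hSY s y, ← pS_eq_sum_pSY]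
    exact hP.2.2 s

/-! ### Blackwell dominance -/

lemma BlackwellDom.refl (Q : Bool → T → ℝ) : BlackwellDom Q Q := by
  refine ⟨fun a b => if a = b then 1 else 0, fun a b => ?_, fun a => by simp, fun y b => by simp⟩
  dsimp only
  split_ifs <;> norm_num

lemma BlackwellDom.trans {T₁ T₂ T₃ : Type} [Fintype T₁] [Fintype T₂] [Fintype T₃]
    {Q₁ : Bool → T₁ → ℝ} {Q₂ : Bool → T₂ → ℝ} {Q₃ : Bool → T₃ → ℝ}
    (h₁ : BlackwellDom Q₁ Q₂) (h₂ : BlackwellDom Q₂ Q₃) : BlackwellDom Q₁ Q₃ := by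
  obtain ⟨G, hG, hG1, hGQ⟩ := h₁
  obtain ⟨K, hK, hK1, hKQ⟩ := h₂
  refine ⟨fun a c => ∑ b, G a b * K b c,
    fun a c => Finset.sum_nonneg fun b _ => mul_nonneg (hG a b) (hK b c), fun a => ?_,
    fun y c => ?_⟩
  · rw [Finset.sum_comm]
    simp_rw [← Finset.mul_sum, hK1, mul_one, hG1]
  · simp_rw [hKQ, hGQ, Finset.sum_mul, Finset.mul_sum]
    rw [Finset.sum_comm]
    simp_rw [mul_assoc]

lemma BlackwellDom.of_equiv {T' : Type} [Fintype T'] (e : T' ≃ T) {Q : Bool → T → ℝ}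
    {Q' : Bool → T' → ℝ} (h : ∀ y a, Q' y a = Q y (e a)) : BlackwellDom Q' Q := by
  refine ⟨fun a b => if e a = b then 1 else 0, fun a b => ?_, fun a => by simp, fun y b => ?_⟩
  · dsimp only
    split_ifs <;> norm_num
  · rw [Fintype.sum_eq_single (e.symm b)]
    · simp [h]
    · intro a ha
      dsimp only
      rw [if_neg, mul_zero]
      rintro rfl
      simp at ha

/-- The sum of squared `y`-masses relative to the total masses is monotone in the Blackwell
order. -/
lemma BlackwellDom.sum_sq_div_le {T' : Type} [Fintype T'] {Q : Bool → T → ℝ}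
    {Q' : Bool → T' → ℝ} (h : BlackwellDom Q Q') (y : Bool)
    (hQ : ∀ t, 0 < Q y t + Q (!y) t) :
    ∑ t, Q' y t ^ 2 / (Q' y t + Q' (!y) t) ≤ ∑ t, Q y t ^ 2 / (Q y t + Q (!y) t) := by
  obtain ⟨G, hG, hG1, hGQ⟩ := h
  have key : ∀ b, Q' y b ^ 2 / (Q' y b + Q' (!y) b) ≤
      ∑ a, Q y a ^ 2 / (Q y a + Q (!y) a) * G a b := by
    intro b
    have hm : Q' y b + Q' (!y) b = ∑ a, (Q y a + Q (!y) a) * G a b := by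
      simp_rw [hGQ, add_mul, Finset.sum_add_distrib]
    have h1 : ∀ a ∈ Finset.univ, 0 ≤ Q y a ^ 2 / (Q y a + Q (!y) a) * G a b := fun a _ =>
      mul_nonneg (div_nonneg (sq_nonneg _) (hQ a).le) (hG a b)
    have h2 : ∀ a ∈ Finset.univ, 0 ≤ (Q y a + Q (!y) a) * G a b := fun a _ =>
      mul_nonneg (hQ a).le (hG a b)
    refine div_le_of_le_mul₀ (hm ▸ Finset.sum_nonneg h2) (Finset.sum_nonneg h1) ?_
    rw [hm, hGQ]
    refine Finset.sum_sq_le_sum_mul_sum_of_sq_le_mul _ h1 h2 fun a _ => le_of_eq ?_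
    have := (hQ a).ne'
    field_simp
  calc _ ≤ ∑ b, ∑ a, Q y a ^ 2 / (Q y a + Q (!y) a) * G a b := Finset.sum_le_sum fun b _ => key b
    _ = _ := by
      rw [Finset.sum_comm]
      simp_rw [← Finset.mul_sum, hG1, mul_one]

/-! ### Optimality -/

lemma BlackwellOptimal.dom_of_dom {T' : Type} [Fintype T'] {ε : ℝ} {P : S → Bool → T → ℝ}
    {P' : S → Bool → T' → ℝ} (h : BlackwellOptimal ε P) (hnn : ∀ s y t, 0 ≤ P' s y t)
    (hip : IsIP ε P') (hSY : ∀ s y, pSY P' s y = pSY P s y)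
    (hdom : BlackwellDom (pYT P') (pYT P)) : BlackwellDom (pYT P) (pYT P') := by
  by_contra hnot
  let e := Fintype.equivFin T'
  let R : S → Bool → Fin (Fintype.card T') → ℝ := fun s y i => P' s y (e.symm i)
  have hRSY : ∀ s y, pSY R s y = pSY P' s y := fun s y =>
    Equiv.sum_comp e.symm fun t => P' s y t
  have hRS : ∀ s, pS R s = pS P' s := fun s => by simp only [pS_eq_sum_pSY, hRSY]
  have hRdom : BlackwellDom (pYT R) (pYT P') := .of_equiv e.symm fun y i => rfl
  refine h.2.2 ⟨_, R, h.1.of_pSY_eq (fun s y i => hnn _ _ _)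
    (fun s y => (hRSY s y).trans (hSY s y)), fun s₁ s₂ i => ?_,
    fun s y => (hRSY s y).trans (hSY s y), ?_, fun hd => hnot ?_⟩
  · have := hip s₁ s₂ (e.symm i)
    simp only [condTS, hRS] at this ⊢
    exact this
  · exact hRdom.trans hdom
  · exact hd.trans hRdom

lemma BlackwellOptimal.of_dom {T' : Type} [Fintype T'] {ε : ℝ} {P : S → Bool → T → ℝ}
    {P' : S → Bool → T' → ℝ} (h : BlackwellOptimal ε P) (hnn : ∀ s y t, 0 ≤ P' s y t)
    (hip : IsIP ε P') (hSY : ∀ s y, pSY P' s y = pSY P s y)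
    (hdom : BlackwellDom (pYT P') (pYT P)) : BlackwellOptimal ε P' := by
  refine ⟨h.1.of_pSY_eq hnn hSY, hip, ?_⟩
  rintro ⟨n, R, hR, hRip, hRSY, hRdom, hRnot⟩
  exact hRnot (hdom.trans (h.dom_of_dom hR.1 hRip
    (fun s y => (hRSY s y).trans (hSY s y)) (hRdom.trans hdom)))

/-! ### Perturbations -/

/-- The structure `P` moved by `δ` in direction `D`. -/
def perturb (P D : S → Bool → T → ℝ) (δ : ℝ) : S → Bool → T → ℝ :=
  fun s y t => P s y t + δ * D s y t

lemma pSY_perturb (P D : S → Bool → T → ℝ) (δ : ℝ) (s : S) (y : Bool) :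
    pSY (perturb P D δ) s y = pSY P s y + δ * pSY D s y := by
  simp only [pSY, perturb, Finset.sum_add_distrib, Finset.mul_sum]

lemma pYT_perturb (P D : S → Bool → T → ℝ) (δ : ℝ) (y : Bool) (t : T) :
    pYT (perturb P D δ) y t = pYT P y t + δ * pYT D y t := by
  simp only [pYT, perturb, Finset.sum_add_distrib, Finset.mul_sum]

lemma pST_perturb (P D : S → Bool → T → ℝ) (δ : ℝ) (s : S) (t : T) :
    pST (perturb P D δ) s t = pST P s t + δ * pST D s t := by
  simp only [pST, perturb, Finset.sum_add_distrib, Finset.mul_sum]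

lemma condTS_perturb {P D : S → Bool → T → ℝ} (hD : ∀ s y, pSY D s y = 0) (δ : ℝ) (s : S)
    (t : T) : condTS (perturb P D δ) t s = condTS P t s + δ * (pST D s t / pS P s) := by
  have : pS (perturb P D δ) s = pS P s := by
    simp only [pS_eq_sum_pSY, pSY_perturb, hD, mul_zero, add_zero]
  rw [condTS, condTS, this, pST_perturb]
  ring

lemma eventually_add_mul_pos {a : ℝ} (ha : 0 < a) (b : ℝ) :
    ∀ᶠ δ in 𝓝[>] (0 : ℝ), 0 < a + δ * b := by
  have hc : ContinuousAt (fun δ : ℝ => a + δ * b) 0 := by fun_prop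
  have : ∀ᶠ δ in 𝓝 (0 : ℝ), 0 < a + δ * b :=
    hc.eventually (lt_mem_nhds (by simpa using ha))
  exact this.filter_mono nhdsWithin_le_nhds

/-- `D` is a direction in which an information structure can be moved while remaining
nonnegative and private and keeping the marginal on `(S,Y)`. -/
structure Feasible (ε : ℝ) (P D : S → Bool → T → ℝ) : Prop where
  pSY_eq : ∀ s y, pSY D s y = 0
  pos_of_neg : ∀ s y t, D s y t < 0 → 0 < P s y t
  tight : ∀ s₁ s₂ t, s₁ ≠ s₂ → condTS P t s₁ = exp ε * condTS P t s₂ →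
    pST D s₁ t ≤ 0 ∧ 0 ≤ pST D s₂ t

lemma Feasible.eventually {ε : ℝ} (hε : 0 ≤ ε) {P D : S → Bool → T → ℝ}
    (hP : InfoStructure P) (hip : IsIP ε P) (h : Feasible ε P D) :
    ∀ᶠ δ in 𝓝[>] (0 : ℝ), 0 < δ ∧ (∀ s y t, 0 ≤ perturb P D δ s y t) ∧
      (∀ s y, pSY (perturb P D δ) s y = pSY P s y) ∧ IsIP ε (perturb P D δ) ∧
      (∀ s y t, 0 < P s y t → 0 < perturb P D δ s y t) ∧
      (∀ s₁ s₂ t, condTS P t s₁ < exp ε * condTS P t s₂ →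
        condTS (perturb P D δ) t s₁ < exp ε * condTS (perturb P D δ) t s₂) := by
  have hpos : ∀ᶠ δ in 𝓝[>] (0 : ℝ), ∀ s y t, 0 < P s y t → 0 < perturb P D δ s y t := by
    simp only [eventually_all]
    exact fun s y t hpos => eventually_add_mul_pos hpos _
  have hlt : ∀ᶠ δ in 𝓝[>] (0 : ℝ), ∀ s₁ s₂ t, condTS P t s₁ < exp ε * condTS P t s₂ →
      condTS (perturb P D δ) t s₁ < exp ε * condTS (perturb P D δ) t s₂ := by
    simp only [eventually_all]
    intro s₁ s₂ t hlt
    filter_upwards [eventually_add_mul_pos (sub_pos.2 hlt)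
      (exp ε * (pST D s₂ t / pS P s₂) - pST D s₁ t / pS P s₁)] with δ hδ
    rw [condTS_perturb h.pSY_eq, condTS_perturb h.pSY_eq]
    linarith
  filter_upwards [self_mem_nhdsWithin, hpos, hlt] with δ hδ hpos hlt
  have hδ : 0 < δ := hδ
  have hnn : ∀ s y t, 0 ≤ perturb P D δ s y t := by
    intro s y t
    by_cases hD : D s y t < 0
    · exact (hpos s y t (h.pos_of_neg s y t hD)).le
    · exact add_nonneg (hP.1 s y t) (mul_nonneg hδ.le (not_lt.1 hD))
  have hSY : ∀ s y, pSY (perturb P D δ) s y = pSY P s y := by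
    intro s y
    rw [pSY_perturb, h.pSY_eq, mul_zero, add_zero]
  refine ⟨hδ, hnn, hSY, fun s₁ s₂ t => ?_, hpos, hlt⟩
  have hk : 1 ≤ exp ε := Real.one_le_exp hε
  rcases eq_or_ne s₁ s₂ with rfl | hne
  · refine le_mul_of_one_le_left ?_ hk
    exact div_nonneg (Finset.sum_nonneg fun y _ => hnn _ _ _)
      ((hP.of_pSY_eq hnn hSY).2.2 _).le
  · rcases (hip s₁ s₂ t).lt_or_eq with hc | hc
    · exact (hlt s₁ s₂ t hc).le
    · obtain ⟨h1, h2⟩ := h.tight s₁ s₂ t hne hc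
      rw [condTS_perturb h.pSY_eq, condTS_perturb h.pSY_eq, hc, mul_add]
      have h3 : δ * (pST D s₁ t / pS P s₁) ≤ 0 :=
        mul_nonpos_of_nonneg_of_nonpos hδ.le
          (div_nonpos_of_nonpos_of_nonneg h1 (hP.2.2 s₁).le)
      have h4 : 0 ≤ exp ε * (δ * (pST D s₂ t / pS P s₂)) :=
        mul_nonneg (exp_pos ε).le (mul_nonneg hδ.le (div_nonneg h2 (hP.2.2 s₂).le))
      linarith

/-! ### Spreading two signals apart -/

lemma sq_div_combination {x z A A' M M' : ℝ} (hM : 0 < M) (hM' : 0 < M')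
    (h : 0 < x * M + z * M') :
    (x * A + z * A') ^ 2 / (x * M + z * M') +
      x * z * (A * M' - A' * M) ^ 2 / (M * M' * (x * M + z * M')) =
      x * (A ^ 2 / M) + z * (A' ^ 2 / M') := by
  field_simp
  ring

/-- Moving `d` of the first mass from the second signal to the first one, and `d'` of the second
mass the other way, is a strict Blackwell improvement if the first signal has the higher
posterior. -/
lemma spread_dom {y : Bool} {Q Q' : Bool → T → ℝ} {t t' : T} (hne : t ≠ t')
    (hQ : ∀ y u, 0 ≤ Q y u) (hQm : ∀ u, 0 < Q y u + Q (!y) u)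
    (hQ' : ∀ y u, 0 ≤ Q' y u) (hQm' : ∀ u, 0 < Q' y u + Q' (!y) u)
    (hcross : Q y t' * Q (!y) t ≤ Q y t * Q (!y) t') {d d' : ℝ} (hd : 0 ≤ d) (hd' : 0 ≤ d')
    (hdd : 0 < d' * (Q y t + Q y t') + d * (Q (!y) t + Q (!y) t'))
    (h1 : Q' y t = Q y t + d) (h2 : Q' (!y) t = Q (!y) t - d')
    (h3 : Q' y t' = Q y t' - d) (h4 : Q' (!y) t' = Q (!y) t' + d')
    (hrest : ∀ y u, u ≠ t → u ≠ t' → Q' y u = Q y u) :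
    BlackwellDom Q' Q ∧ ¬ BlackwellDom Q Q' := by
  obtain ⟨a, ha⟩ : ∃ a, a = Q y t := ⟨_, rfl⟩
  obtain ⟨b, hb⟩ : ∃ b, b = Q (!y) t := ⟨_, rfl⟩
  obtain ⟨a', ha'⟩ : ∃ a, a = Q y t' := ⟨_, rfl⟩
  obtain ⟨b', hb'⟩ : ∃ b, b = Q (!y) t' := ⟨_, rfl⟩
  have a0 := hQ y t
  have b0 := hQ (!y) t
  have a0' := hQ y t'
  have b0' := hQ (!y) t'
  have A0 := hQ' y t
  have B0 := hQ' (!y) t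
  have A0' := hQ' y t'
  have B0' := hQ' (!y) t'
  have m0 := hQm t
  have m0' := hQm t'
  have M0 := hQm' t
  have M0' := hQm' t'
  rw [h1, h2] at M0
  rw [h3, h4] at M0'
  rw [h1] at A0
  rw [h2] at B0
  rw [h3] at A0'
  rw [h4] at B0'
  rw [← hb, ← ha'] at hcross
  rw [← ha] at hcross hdd a0 A0 m0 M0 h1
  rw [← hb] at hdd b0 B0 m0 M0 h2
  rw [← ha'] at hdd a0' A0' m0' M0' h3
  rw [← hb'] at hcross hdd b0' B0' m0' M0' h4
  set Δ : ℝ := (a * b' - a' * b) + (d' * (a + a') + d * (b + b')) with hΔ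
  have hΔ0 : 0 < Δ := by linarith
  obtain ⟨α, hα⟩ : ∃ α, α = (d * b' + d' * a') / Δ := ⟨_, rfl⟩
  obtain ⟨β, hβ⟩ : ∃ β, β = (d * b + d' * a) / Δ := ⟨_, rfl⟩
  have hα0 : 0 ≤ α := hα ▸ by positivity
  have hβ0 : 0 ≤ β := hβ ▸ by positivity
  have hs : α + β ≤ 1 := by
    rw [hα, hβ, ← add_div, div_le_one hΔ0]
    linarith
  have hs0 : 0 < α + β := by
    rw [hα, hβ, ← add_div]
    exact div_pos (by linarith) hΔ0
  have e1 : a = (1 - α) * (a + d) + β * (a' - d) := by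
    rw [hα, hβ]; field_simp; rw [hΔ]; ring
  have e2 : b = (1 - α) * (b - d') + β * (b' + d') := by
    rw [hα, hβ]; field_simp; rw [hΔ]; ring
  have e3 : a' = α * (a + d) + (1 - β) * (a' - d) := by linear_combination -e1
  have e4 : b' = α * (b - d') + (1 - β) * (b' + d') := by linear_combination -e2
  have split : ∀ f : T → ℝ, ∑ u, f u = f t + f t' + ∑ u ∈ {t, t'}ᶜ, f u := by
    intro f
    rw [← Finset.sum_add_sum_compl {t, t'}, Finset.sum_pair hne]
  have hmem : ∀ u ∈ ({t, t'}ᶜ : Finset T), u ≠ t ∧ u ≠ t' := by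
    intro u hu
    simpa using hu
  constructor
  · refine ⟨fun u v => if u = t then (if v = t then 1 - α else if v = t' then α else 0)
      else if u = t' then (if v = t then β else if v = t' then 1 - β else 0)
      else if u = v then 1 else 0, fun u v => ?_, fun u => ?_, fun z v => ?_⟩
    · dsimp only
      split_ifs <;> linarith
    · by_cases hu : u = t
      · rw [split, Finset.sum_eq_zero]
        · simp [hu, hne.symm]
        · intro v hv
          simp [hu, hmem v hv]
      · by_cases hu' : u = t'
        · rw [split, Finset.sum_eq_zero]
          · simp [hu', hne.symm]
          · intro v hv
            simp [hu', hne.symm, hmem v hv]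
        · simp [hu, hu']
    · rw [split]
      by_cases hv : v = t
      · rw [Finset.sum_eq_zero]
        · rcases Bool.eq_or_eq_not z y with rfl | rfl
          · simp [hv, hne.symm, h1, h3, ← ha]
            linarith
          · simp [hv, hne.symm, h2, h4, ← hb]
            linarith
        · intro u hu
          simp [hv, hmem u hu]
      · by_cases hv' : v = t'
        · rw [Finset.sum_eq_zero]
          · rcases Bool.eq_or_eq_not z y with rfl | rfl
            · simp [hv', hne.symm, h1, h3, ← ha']
              linarith
            · simp [hv', hne.symm, h2, h4, ← hb']
              linarith
          · intro u hu
            simp [hv', hmem u hu]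
        · rw [Finset.sum_eq_single v]
          · simp [hv, hv', hne.symm, hrest z v hv hv']
          · intro u hu huv
            simp [hmem u hu, huv]
          · simp [hv, hv']
  · intro hdom
    have hle := hdom.sum_sq_div_le y hQm
    rw [split, split] at hle
    rw [Finset.sum_congr rfl (g := fun u => Q y u ^ 2 / (Q y u + Q (!y) u))] at hle
    swap
    · intro u hu
      rw [hrest _ _ (hmem u hu).1 (hmem u hu).2, hrest _ _ (hmem u hu).1 (hmem u hu).2]
    simp only [h1, h2, h3, h4, ← ha, ← hb, ← ha', ← hb'] at hle
    have hm : a + b = (1 - α) * (a + d + (b - d')) + β * (a' - d + (b' + d')) := by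
      linear_combination e1 + e2
    have hm' : a' + b' = α * (a + d + (b - d')) + (1 - β) * (a' - d + (b' + d')) := by
      linear_combination e3 + e4
    have c1 := sq_div_combination (A := a + d) (A' := a' - d) M0 M0' (hm ▸ m0)
    have c2 := sq_div_combination (A := a + d) (A' := a' - d) M0 M0' (hm' ▸ m0')
    rw [← hm, ← e1] at c1
    rw [← hm', ← e3] at c2
    have hΔ' : (a + d) * (a' - d + (b' + d')) - (a' - d) * (a + d + (b - d')) = Δ := by
      rw [hΔ]; ring
    rw [hΔ'] at c1 c2
    have hpos : 0 < (1 - α) * β * Δ ^ 2 / ((a + d + (b - d')) * (a' - d + (b' + d')) * (a + b)) +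
        α * (1 - β) * Δ ^ 2 / ((a + d + (b - d')) * (a' - d + (b' + d')) * (a' + b')) := by
      have hx : 0 ≤ 1 - α := by linarith
      have hz : 0 ≤ 1 - β := by linarith
      rcases hα0.eq_or_lt with h | h
      · have hβ' : 0 < β := by linarith
        rw [← h]
        have : 0 < (1 - 0) * β * Δ ^ 2 /
          ((a + d + (b - d')) * (a' - d + (b' + d')) * (a + b)) := by positivity
        simpa using this
      · rcases hβ0.eq_or_lt with h' | h'
        · rw [← h']
          have : 0 < α * (1 - 0) * Δ ^ 2 /
            ((a + d + (b - d')) * (a' - d + (b' + d')) * (a' + b')) := by positivity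
          simpa using this
        · have hx' : 0 < 1 - α := by linarith
          positivity
    linarith

/-- An optimal structure admits no feasible direction which spreads two signals apart. -/
lemma BlackwellOptimal.not_spread {ε : ℝ} (hε : 0 ≤ ε) {P D : S → Bool → T → ℝ}
    (hopt : BlackwellOptimal ε P) (hT : ∀ t, 0 < pT P t) (hD : Feasible ε P D) {t t' : T}
    (hne : t ≠ t') (y : Bool)
    (hcross : pYT P y t' * pYT P (!y) t ≤ pYT P y t * pYT P (!y) t') {d d' : ℝ}
    (hd : 0 ≤ d) (hd' : 0 ≤ d')
    (hdd : 0 < d' * (pYT P y t + pYT P y t') + d * (pYT P (!y) t + pYT P (!y) t'))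
    (h1 : pYT D y t = d) (h2 : pYT D (!y) t = - d')
    (h3 : pYT D y t' = - d) (h4 : pYT D (!y) t' = d')
    (hrest : ∀ y u, u ≠ t → u ≠ t' → pYT D y u = 0) : False := by
  have hTpos : ∀ᶠ δ in 𝓝[>] (0 : ℝ), ∀ u, 0 < pT P u + δ * pT D u := by
    rw [eventually_all]
    exact fun u => eventually_add_mul_pos (hT u) _
  obtain ⟨δ, ⟨hδ, hnn, hSY, hip, -, -⟩, hm⟩ :=
    ((hD.eventually hε hopt.1 hopt.2.1).and hTpos).exists
  have hs := spread_dom (y := y) (Q := pYT P) (Q' := pYT (perturb P D δ)) (d := δ * d)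
    (d' := δ * d') hne (pYT_nonneg hopt.1.1) (fun u => pT_eq_add P y u ▸ hT u) (pYT_nonneg hnn)
    (fun u => ?_) hcross (by positivity) (by positivity) ?_ ?_ ?_ ?_ ?_ ?_
  · exact hs.2 (hopt.dom_of_dom hnn hip hSY hs.1)
  · have := hm u
    rw [pT_eq_add P y, pT_eq_add D y] at this
    rw [pYT_perturb, pYT_perturb]
    linarith
  · have := mul_pos hδ hdd
    linarith
  · rw [pYT_perturb, h1]
  · rw [pYT_perturb, h2]; ring
  · rw [pYT_perturb, h3]; ring
  · rw [pYT_perturb, h4]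
  · intro z u hu hu'
    rw [pYT_perturb, hrest z u hu hu', mul_zero, add_zero]

/-! ### Elementary moves -/

/-- The direction moving mass of secret `s` and state `y` from signal `t'` to signal `t`. -/
def move (s : S) (y : Bool) (t t' : T) : S → Bool → T → ℝ :=
  fun s₀ y₀ u => if s₀ = s ∧ y₀ = y then (if u = t then 1 else 0) - (if u = t' then 1 else 0)
    else 0

lemma pSY_move (s : S) (y : Bool) (t t' : T) (s₀ : S) (y₀ : Bool) :
    pSY (move s y t t') s₀ y₀ = 0 := by
  simp only [pSY, move]
  split_ifs <;> simp

lemma pYT_move (s : S) (y : Bool) (t t' : T) (y₀ : Bool) (u : T) :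
    pYT (move s y t t') y₀ u =
      if y₀ = y then (if u = t then 1 else 0) - (if u = t' then 1 else 0) else 0 := by
  simp only [pYT, move]
  rw [Fintype.sum_eq_single s]
  · simp
  · intro x hx
    simp [hx]

lemma pST_move (s : S) (y : Bool) (t t' : T) (s₀ : S) (u : T) :
    pST (move s y t t') s₀ u =
      if s₀ = s then (if u = t then 1 else 0) - (if u = t' then 1 else 0) else 0 := by
  simp only [pST, move]
  rw [Fintype.sum_eq_single y]
  · simp
  · intro x hx
    simp [hx]

lemma eq_of_move_neg {s : S} {y : Bool} {t t' : T} {s₀ : S} {y₀ : Bool} {u : T}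
    (h : move s y t t' s₀ y₀ u < 0) : s₀ = s ∧ y₀ = y ∧ u = t' := by
  unfold move at h
  split_ifs at h with h1 h2 h3 h3
  all_goals first | exact ⟨h1.1, h1.2, h3⟩ | norm_num at h

lemma pSY_add (D D' : S → Bool → T → ℝ) (s : S) (y : Bool) :
    pSY (D + D') s y = pSY D s y + pSY D' s y := by
  simp [pSY, Finset.sum_add_distrib]

lemma pYT_add (D D' : S → Bool → T → ℝ) (y : Bool) (t : T) :
    pYT (D + D') y t = pYT D y t + pYT D' y t := by
  simp [pYT, Finset.sum_add_distrib]

lemma pST_add (D D' : S → Bool → T → ℝ) (s : S) (t : T) :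
    pST (D + D') s t = pST D s t + pST D' s t := by
  simp only [pST, Pi.add_apply, Finset.sum_add_distrib]

/-- Every signal duplicated, with half of the mass on each copy. -/
def duplicate (P : S → Bool → T → ℝ) : S → Bool → T × Bool → ℝ := fun s y u => P s y u.1 / 2

lemma pSY_duplicate (P : S → Bool → T → ℝ) (s : S) (y : Bool) :
    pSY (duplicate P) s y = pSY P s y := by
  simp [pSY, duplicate, Fintype.sum_prod_type, mul_div_cancel₀]

lemma pST_duplicate (P : S → Bool → T → ℝ) (s : S) (u : T × Bool) :
    pST (duplicate P) s u = pST P s u.1 / 2 := by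
  simp only [pST, duplicate, Finset.sum_div]

lemma pYT_duplicate (P : S → Bool → T → ℝ) (y : Bool) (u : T × Bool) :
    pYT (duplicate P) y u = pYT P y u.1 / 2 := by
  simp only [pYT, duplicate, Finset.sum_div]

lemma condTS_duplicate (P : S → Bool → T → ℝ) (s : S) (u : T × Bool) :
    condTS (duplicate P) u s = condTS P u.1 s / 2 := by
  simp only [condTS, pST_duplicate, pS_eq_sum_pSY, pSY_duplicate]
  ring

lemma BlackwellOptimal.duplicate {ε : ℝ} {P : S → Bool → T → ℝ} (h : BlackwellOptimal ε P) :
    BlackwellOptimal ε (duplicate P) := by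
  refine h.of_dom (fun s y u => div_nonneg (h.1.1 _ _ _) (by norm_num)) (fun s₁ s₂ u => ?_)
    (pSY_duplicate P) ⟨fun u t => if u.1 = t then 1 else 0, fun u t => ?_, fun u => by simp,
      fun y t => ?_⟩
  · rw [condTS_duplicate, condTS_duplicate]
    linarith [h.2.1 s₁ s₂ u.1]
  · dsimp only
    split_ifs <;> norm_num
  · simp [Fintype.sum_prod_type, pYT_duplicate, mul_div_cancel₀]

lemma pT_duplicate_pos {P : S → Bool → T → ℝ} (hT : ∀ t, 0 < pT P t) (u : T × Bool) :
    0 < pT (duplicate P) u := by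
  have := hT u.1
  rw [pT_eq_add _ true] at this ⊢
  rw [pYT_duplicate, pYT_duplicate]
  linarith

lemma neg_or_neg_of_add_neg {a b : ℝ} (h : a + b < 0) : a < 0 ∨ b < 0 := by
  by_contra! hc
  linarith [hc.1, hc.2]

/-! ### Exchange arguments -/

/-- Exchanging the states of two signals within one secret. -/
lemma BlackwellOptimal.not_swap {ε : ℝ} (hε : 0 ≤ ε) {P : S → Bool → T → ℝ}
    (hopt : BlackwellOptimal ε P) (hT : ∀ t, 0 < pT P t) {t t' : T} (hne : t ≠ t')
    (hcross : pYT P true t' * pYT P false t ≤ pYT P true t * pYT P false t') {s : S}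
    (h : 0 < P s false t) (h' : 0 < P s true t') : False := by
  refine hopt.not_spread hε (D := move s true t t' + move s false t' t) hT
    ⟨fun s₀ y => ?_, fun s₀ y u hneg => ?_, fun s₁ s₂ u _ _ => ?_⟩ hne true hcross
    zero_le_one zero_le_one ?_ ?_ ?_ ?_ ?_ ?_
  · rw [pSY_add, pSY_move, pSY_move, add_zero]
  · rcases neg_or_neg_of_add_neg hneg with hn | hn <;>
    · obtain ⟨rfl, rfl, rfl⟩ := eq_of_move_neg hn
      assumption
  · have hz : ∀ s₀, pST (move s true t t' + move s false t' t) s₀ u = 0 := by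
      intro s₀
      rw [pST_add, pST_move, pST_move]
      split_ifs <;> norm_num
    simp [hz]
  · have h1 := hT t
    have h2 := hT t'
    rw [pT_eq_add _ true] at h1 h2
    linarith
  all_goals simp +contextual [pYT_add, pYT_move, hne, hne.symm]

/-- Moving mass with the majority state towards the more extreme signal. -/
lemma BlackwellOptimal.not_shift {ε : ℝ} (hε : 0 ≤ ε) {P : S → Bool → T → ℝ}
    (hopt : BlackwellOptimal ε P) (hT : ∀ t, 0 < pT P t) {t t' : T} (hne : t ≠ t') (y : Bool)
    (hcross : pYT P y t' * pYT P (!y) t ≤ pYT P y t * pYT P (!y) t')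
    (hmix : 0 < pYT P (!y) t') {s s₁ s₂ : S}
    (h : 0 < P s y t') (hlow : condTS P t' s₁ < condTS P t' s)
    (hhigh : condTS P t s < condTS P t s₂) : False := by
  have htight : ∀ r₁ r₂ u, r₁ ≠ r₂ → condTS P u r₁ = exp ε * condTS P u r₂ →
      pST (move s y t t') r₁ u ≤ 0 ∧ 0 ≤ pST (move s y t t') r₂ u := by
    intro r₁ r₂ u hr hc
    rw [pST_move, pST_move]
    constructor
    · split_ifs with h1 h2 h3 h3
      · simp
      · subst h1 h2
        linarith [hopt.2.1 s₂ r₂ u]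
      · norm_num
      · simp
      · rfl
    · split_ifs with h1 h2 h3 h3
      · simp
      · norm_num
      · subst h1 h3
        have := hopt.2.1 r₁ s₁ u
        have := mul_lt_mul_of_pos_left hlow (exp_pos ε)
        linarith
      · simp
      · rfl
  refine hopt.not_spread hε (D := move s y t t') hT
    ⟨fun s₀ z => pSY_move _ _ _ _ _ _, fun s₀ z u hneg => ?_, htight⟩ hne y hcross
    zero_le_one le_rfl ?_ ?_ ?_ ?_ ?_ ?_
  · obtain ⟨rfl, rfl, rfl⟩ := eq_of_move_neg hneg
    exact h
  · linarith [pYT_nonneg hopt.1.1 (!y) t]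
  all_goals simp +contextual [pYT_move, hne, hne.symm]

/-- The state is a function of the secret and the signal. -/
lemma BlackwellOptimal.not_both_pos {ε : ℝ} (hε : 0 ≤ ε) {P : S → Bool → T → ℝ}
    (hopt : BlackwellOptimal ε P) (hT : ∀ t, 0 < pT P t) {s : S} {t : T} {y : Bool}
    (h : 0 < P s y t) (h' : 0 < P s (!y) t) : False := by
  have key : ∀ z, 0 < P s z t := fun z => by
    rcases Bool.eq_or_eq_not z y with rfl | rfl <;> assumption
  refine hopt.duplicate.not_swap hε (pT_duplicate_pos hT) (t := (t, true)) (t' := (t, false))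
    (s := s) (by simp) ?_ (half_pos (key false)) (half_pos (key true))
  simp [pYT_duplicate]

/-- The likelihood of a signal with a nondegenerate posterior is extremal at every secret. -/
lemma BlackwellOptimal.not_slack {ε : ℝ} (hε : 0 ≤ ε) {P : S → Bool → T → ℝ}
    (hopt : BlackwellOptimal ε P) (hT : ∀ t, 0 < pT P t) {s : S} {t : T} (y : Bool)
    (hpos : 0 < P s y t) (hmix : 0 < pYT P (!y) t)
    (hslack : ∀ s' ≠ s, condTS P t s' < exp ε * condTS P t s ∧
      condTS P t s < exp ε * condTS P t s') : False := by
  have hne : ((t, true) : T × Bool) ≠ (t, false) := by simp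
  have htight : ∀ r₁ r₂ u, r₁ ≠ r₂ →
      condTS (IPPaper.duplicate P) u r₁ = exp ε * condTS (IPPaper.duplicate P) u r₂ →
      pST (move s y (t, true) (t, false)) r₁ u ≤ 0 ∧
        0 ≤ pST (move s y (t, true) (t, false)) r₂ u := by
    intro r₁ r₂ u hr hc
    rw [condTS_duplicate, condTS_duplicate] at hc
    rw [pST_move, pST_move]
    by_cases hu : u.1 = t
    · rw [hu] at hc
      have h1 : r₁ ≠ s := by
        rintro rfl
        linarith [(hslack r₂ hr.symm).2]
      have h2 : r₂ ≠ s := by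
        rintro rfl
        linarith [(hslack r₁ hr).1]
      simp [h1, h2]
    · have h1 : u ≠ (t, true) := fun h => hu (by rw [h])
      have h2 : u ≠ (t, false) := fun h => hu (by rw [h])
      simp [h1, h2]
  refine hopt.duplicate.not_spread hε (D := move s y (t, true) (t, false))
    (pT_duplicate_pos hT)
    ⟨fun s₀ z => pSY_move _ _ _ _ _ _, fun s₀ z u hneg => ?_, htight⟩ hne y ?_
    zero_le_one le_rfl ?_ ?_ ?_ ?_ ?_ ?_
  · obtain ⟨rfl, rfl, rfl⟩ := eq_of_move_neg hneg
    exact half_pos hpos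
  · simp [pYT_duplicate]
  · simp only [pYT_duplicate]
    linarith
  all_goals simp +contextual [pYT_move]

lemma BlackwellOptimal.exists_condTS_lt {ε : ℝ} (hε : 0 < ε) {P : S → Bool → T → ℝ}
    (hopt : BlackwellOptimal ε P) (hT : ∀ t, 0 < pT P t) {s : S} {t : T} (y : Bool)
    (hpos : 0 < P s y t) (hmix : 0 < pYT P (!y) t) (hmax : ∀ s', condTS P t s' ≤ condTS P t s) :
    ∃ s', condTS P t s' < condTS P t s := by
  by_contra! hc
  have hk : 1 < exp ε := Real.one_lt_exp_iff.2 hε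
  have h0 : 0 < condTS P t s := by
    refine div_pos ?_ (hopt.1.2.2 s)
    rw [pST_eq_add P s y]
    exact add_pos_of_pos_of_nonneg hpos (hopt.1.1 _ _ _)
  refine hopt.not_slack hε.le hT y hpos hmix fun s' _ => ?_
  rw [(hmax s').antisymm (hc s')]
  exact ⟨lt_mul_of_one_lt_left h0 hk, lt_mul_of_one_lt_left h0 hk⟩

lemma IsIP.exchange_tight {ε : ℝ} {P D : S → Bool → T → ℝ} (hip : IsIP ε P) {s s' : S}
    {t t' : T} (hc : condTS P t s < condTS P t s') (hc' : condTS P t' s' < condTS P t' s)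
    (hD : ∀ r u, pST D r u =
      (if r = s then (if u = t then 1 else 0) - (if u = t' then 1 else 0) else 0) +
      (if r = s' then (if u = t' then 1 else 0) - (if u = t then 1 else 0) else 0))
    {r₁ r₂ : S} {u : T} (hu : condTS P u r₁ = exp ε * condTS P u r₂) :
    pST D r₁ u ≤ 0 ∧ 0 ≤ pST D r₂ u := by
  have hss : s ≠ s' := by
    rintro rfl
    exact lt_irrefl _ hc
  have htt : t ≠ t' := by
    rintro rfl
    exact lt_asymm hc hc'
  have h1 : ¬ (r₁ = s ∧ u = t) := by
    rintro ⟨rfl, rfl⟩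
    linarith [hip s' r₂ u]
  have h2 : ¬ (r₁ = s' ∧ u = t') := by
    rintro ⟨rfl, rfl⟩
    linarith [hip s r₂ u]
  have h3 : ¬ (r₂ = s' ∧ u = t) := by
    rintro ⟨rfl, rfl⟩
    linarith [hip r₁ s u, mul_lt_mul_of_pos_left hc (exp_pos ε)]
  have h4 : ¬ (r₂ = s ∧ u = t') := by
    rintro ⟨rfl, rfl⟩
    linarith [hip r₁ s' u, mul_lt_mul_of_pos_left hc' (exp_pos ε)]
  rw [hD, hD]
  constructor
  · split_ifs <;> first | (norm_num; done) | simp_all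
  · split_ifs <;> first | (norm_num; done) | simp_all

/-- Two secrets exchanging mass with the same state between two signals. -/
lemma BlackwellOptimal.not_exchange {ε : ℝ} (hε : 0 ≤ ε) {P : S → Bool → T → ℝ}
    (hopt : BlackwellOptimal ε P) (hT : ∀ t, 0 < pT P t) {s s' : S} {t t' : T} (y : Bool)
    (hmix : 0 < pYT P (!y) t) (h : 0 < P s y t) (h' : 0 < P s' y t')
    (hc : condTS P t s' < condTS P t s) (hc' : condTS P t' s < condTS P t' s') : False := by
  have hss : s ≠ s' := by
    rintro rfl
    exact lt_irrefl _ hc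
  have htt : t ≠ t' := by
    rintro rfl
    exact lt_asymm hc hc'
  set D : S → Bool → T → ℝ := move s y t' t + move s' y t t' with hD
  have hDST : ∀ r u, pST D r u =
      (if r = s then (if u = t' then 1 else 0) - (if u = t then 1 else 0) else 0) +
      (if r = s' then (if u = t then 1 else 0) - (if u = t' then 1 else 0) else 0) := by
    intro r u
    rw [hD, pST_add, pST_move, pST_move]
  have hDYT : ∀ z u, pYT D z u = 0 := by
    intro z u
    rw [hD, pYT_add, pYT_move, pYT_move]
    split_ifs <;> norm_num
  have hfeas : Feasible ε P D := by
    refine ⟨fun r z => ?_, fun r z u hneg => ?_, fun r₁ r₂ u hr hu => ?_⟩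
    · rw [hD, pSY_add, pSY_move, pSY_move, add_zero]
    · rcases neg_or_neg_of_add_neg hneg with hn | hn <;>
      · obtain ⟨rfl, rfl, rfl⟩ := eq_of_move_neg hn
        assumption
    · exact hopt.2.1.exchange_tight hc' hc hDST hu
  obtain ⟨δ, hδ, hnn, hSY, hip, hpos, hlt⟩ := (hfeas.eventually hε hopt.1 hopt.2.1).exists
  have hYT : pYT (perturb P D δ) = pYT P := by
    ext z u
    rw [pYT_perturb, hDYT, mul_zero, add_zero]
  have hopt' := hopt.of_dom hnn hip hSY (hYT ▸ BlackwellDom.refl _)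
  refine hopt'.not_slack hε (fun u => ?_) y (hpos s y t h) (hYT ▸ hmix) fun r hr => ⟨?_, ?_⟩
  · rw [pT_eq_add _ true, hYT, ← pT_eq_add]
    exact hT u
  · refine hlt _ _ _ ((hopt.2.1 r s' t).trans_lt ?_)
    exact mul_lt_mul_of_pos_left hc (exp_pos ε)
  · rw [condTS_perturb hfeas.pSY_eq, condTS_perturb hfeas.pSY_eq]
    have h1 : pST D s t = -1 := by simp [hDST, hss, htt]
    have h2 : 0 ≤ pST D r t := by
      rw [hDST, if_neg hr]
      simp only [if_neg htt, if_true]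
      split_ifs <;> norm_num
    have h3 : δ * (pST D s t / pS P s) < 0 :=
      mul_neg_of_pos_of_neg hδ (div_neg_of_neg_of_pos (by rw [h1]; norm_num) (hopt.1.2.2 s))
    have h4 : 0 ≤ exp ε * (δ * (pST D r t / pS P r)) :=
      mul_nonneg (exp_pos ε).le (mul_nonneg hδ.le (div_nonneg h2 (hopt.1.2.2 r).le))
    linarith [hopt.2.1 s r t]

/-- Two secrets exchanging mass with different states between two signals, compensated at a third
signal at which their states differ. -/
lemma BlackwellOptimal.not_cycle {ε : ℝ} (hε : 0 ≤ ε) {P : S → Bool → T → ℝ}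
    (hopt : BlackwellOptimal ε P) (hT : ∀ t, 0 < pT P t) {s s' : S} {t t' t₀ : T} (y : Bool)
    (h : 0 < P s' y t) (h' : 0 < P s (!y) t') (h₀ : 0 < P s y t₀) (h₀' : 0 < P s' (!y) t₀)
    (hc : condTS P t s < condTS P t s') (hc' : condTS P t' s' < condTS P t' s) : False := by
  have hss : s ≠ s' := by
    rintro rfl
    exact lt_irrefl _ hc
  have htt : t ≠ t' := by
    rintro rfl
    exact lt_asymm hc hc'
  have ht₀ : t₀ ≠ t' := by
    rintro rfl
    exact hopt.not_both_pos hε hT h₀ h'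
  set D : S → Bool → T → ℝ := (move s y t t₀ + move s (!y) t₀ t') +
    (move s' y t₀ t + move s' (!y) t' t₀) with hD
  have hDST : ∀ r u, pST D r u =
      (if r = s then (if u = t then 1 else 0) - (if u = t' then 1 else 0) else 0) +
      (if r = s' then (if u = t' then 1 else 0) - (if u = t then 1 else 0) else 0) := by
    intro r u
    simp only [hD, pST_add, pST_move]
    split_ifs <;> norm_num
  have hDYT : ∀ z u, pYT D z u = 0 := by
    intro z u
    simp only [hD, pYT_add, pYT_move]
    split_ifs <;> norm_num
  have hfeas : Feasible ε P D := by
    refine ⟨fun r z => ?_, fun r z u hneg => ?_, fun r₁ r₂ u hr hu => ?_⟩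
    · simp only [hD, pSY_add, pSY_move, add_zero]
    · rcases neg_or_neg_of_add_neg hneg with hn | hn <;>
      rcases neg_or_neg_of_add_neg hn with hn | hn <;>
      · obtain ⟨rfl, rfl, rfl⟩ := eq_of_move_neg hn
        assumption
    · exact hopt.2.1.exchange_tight hc hc' hDST hu
  obtain ⟨δ, hδ, hnn, hSY, hip, hpos, -⟩ := (hfeas.eventually hε hopt.1 hopt.2.1).exists
  have hYT : pYT (perturb P D δ) = pYT P := by
    ext z u
    rw [pYT_perturb, hDYT, mul_zero, add_zero]
  have hopt' := hopt.of_dom hnn hip hSY (hYT ▸ BlackwellDom.refl _)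
  refine hopt'.not_both_pos hε (fun u => ?_) (hpos s y t₀ h₀) ?_
  · rw [pT_eq_add _ true, hYT, ← pT_eq_add]
    exact hT u
  · have h1 : D s (!y) t₀ = 1 := by simp [hD, move, hss, ht₀]
    rw [perturb, h1, mul_one]
    exact add_pos_of_nonneg_of_pos (hopt.1.1 _ _ _) hδ

/-! ### Monotonicity -/

lemma InfoStructure.nonneg {P : S → Bool → T → ℝ} (hP : InfoStructure P) (s : S) (y : Bool)
    (t : T) : 0 ≤ P s y t := hP.1 s y t

lemma condTS_eq_of_eq_zero {P : S → Bool → T → ℝ} {s : S} {y : Bool} {t : T}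
    (h : P s (!y) t = 0) : condTS P t s = P s y t / pS P s := by
  rw [condTS, pST_eq_add P s y, h, add_zero]

lemma sum_div_pS (P : S → Bool → T → ℝ) (s : S) (y : Bool) :
    ∑ t, P s y t / pS P s = pSY P s y / pS P s := by
  rw [← Finset.sum_div, pSY]

lemma div_pS_add_div_pS {P : S → Bool → T → ℝ} {s : S} (hs : 0 < pS P s) :
    pSY P s true / pS P s + pSY P s false / pS P s = 1 := by
  rw [← add_div, div_eq_one_iff_eq hs.ne', pS_eq_sum_pSY, Fintype.sum_bool]

/-- If `s'` has the larger share of state `y` and never produces the other state where `s` does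
not, then its likelihood of a signal which is nondegenerate, and certain under `s`, is at least
that of `s`. -/
lemma BlackwellOptimal.condTS_le_condTS {ε : ℝ} (hε : 0 ≤ ε) {P : S → Bool → T → ℝ}
    (hopt : BlackwellOptimal ε P) (hpos : ∀ s t, 0 < pST P s t) (hT : ∀ t, 0 < pT P t)
    {s s' : S} (y : Bool) (hle : pSY P s y / pS P s ≤ pSY P s' y / pS P s')
    (hnest : ∀ t, P s (!y) t = 0 → P s' (!y) t = 0) {t : T} (hmix : 0 < pYT P (!y) t)
    (ht : P s (!y) t = 0) : condTS P t s ≤ condTS P t s' := by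
  by_contra! hc
  have hS := hopt.1.2.2
  have hpos_or : ∀ r z u, P r z u = 0 → 0 < P r (!z) u := fun r z u h => by
    have := hpos r u
    rwa [pST_eq_add P r z, h, zero_add] at this
  have hpos_of : ∀ r z u, P r (!z) u = 0 → 0 < P r z u := fun r z u h => by
    simpa using hpos_or r (!z) u h
  have hex : ∀ u, 0 < P s' y u → condTS P u s' ≤ condTS P u s := fun u hu => by
    by_contra! hlt
    exact hopt.not_exchange hε hT y hmix (hpos_of s y t ht) hu hc hlt
  obtain ⟨t', -, ht'⟩ : ∃ u ∈ Finset.univ, condTS P u s < condTS P u s' := by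
    by_contra! hall
    have := Finset.sum_lt_sum hall ⟨t, Finset.mem_univ t, hc⟩
    rw [sum_condTS (hS s), sum_condTS (hS s')] at this
    exact lt_irrefl _ this
  have ht'0 : P s' y t' = 0 := by
    by_contra hne
    exact absurd (hex t' ((hopt.1.nonneg _ _ _).lt_of_ne' hne)) (not_le.2 ht')
  obtain ⟨d, hd, hd'⟩ : ∃ d, 0 < P s' y d ∧ 0 < P s (!y) d := by
    by_contra! hall
    refine hle.not_gt ?_
    rw [← sum_div_pS, ← sum_div_pS]
    refine Finset.sum_lt_sum (fun u _ => ?_) ⟨t, Finset.mem_univ t, ?_⟩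
    · rcases (hopt.1.nonneg s' y u).eq_or_lt with h | h
      · rw [← h, zero_div]
        exact div_nonneg (hopt.1.nonneg _ _ _) (hS s).le
      · have hu := (hall u h).antisymm (hopt.1.nonneg _ _ _)
        rw [← condTS_eq_of_eq_zero hu, ← condTS_eq_of_eq_zero (hnest u hu)]
        exact hex u h
    · rwa [← condTS_eq_of_eq_zero ht, ← condTS_eq_of_eq_zero (hnest t ht)]
  exact hopt.not_cycle hε hT y (hpos_of s y t ht) (hpos_or s' y t' ht'0) hd hd' hc ht'

/-- Signals determining state `1` at a secret determine it at every secret with a larger prior. -/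
lemma BlackwellOptimal.eq_zero_of_qS_le {ε : ℝ} (hε : 0 ≤ ε) {P : S → Bool → T → ℝ}
    (hopt : BlackwellOptimal ε P) (hpos : ∀ s t, 0 < pST P s t) (hT : ∀ t, 0 < pT P t)
    (hrow : ∀ t t', postYT P t' ≤ postYT P t → ∀ s, P s true t' ≠ 0 → t ≠ t' → P s false t = 0)
    {s s' : S} (hle : qS P s ≤ qS P s') {t : T} (ht : P s false t = 0) :
    P s' false t = 0 := by
  by_contra hne
  have hS := hopt.1.2.2
  have hpos' : 0 < P s' false t := (hopt.1.nonneg _ _ _).lt_of_ne' hne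
  have htrue : ∀ r u, P r false u = 0 → 0 < P r true u := fun r u h => by
    have := hpos r u
    rwa [pST_eq_add P r true, Bool.not_true, h, add_zero] at this
  have htrue0 : P s' true t = 0 := by
    by_contra h
    exact hopt.not_both_pos hε hT (y := true) ((hopt.1.nonneg _ _ _).lt_of_ne' h) hpos'
  have hfalse0 : ∀ r u, 0 < P r true u → P r false u = 0 := fun r u h => by
    by_contra h'
    exact hopt.not_both_pos hε hT (y := true) h ((hopt.1.nonneg _ _ _).lt_of_ne' h')
  have hnest : ∀ u, P s' false u = 0 → P s false u = 0 := by
    intro u hu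
    have hut : u ≠ t := by
      rintro rfl
      exact hne hu
    rcases le_total (postYT P u) (postYT P t) with h | h
    · exact absurd (hrow t u h s' (htrue s' u hu).ne' hut.symm) hne
    · exact hrow u t h s (htrue s t ht).ne' hut
  have hqle : pSY P s true / pS P s ≤ pSY P s' true / pS P s' := hle
  obtain ⟨u, hu, huc⟩ : ∃ u, 0 < P s' true u ∧ condTS P u s < condTS P u s' := by
    by_contra! hall
    refine hqle.not_gt ?_
    rw [← sum_div_pS, ← sum_div_pS]
    refine Finset.sum_lt_sum (fun u _ => ?_) ⟨t, Finset.mem_univ t, ?_⟩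
    · rcases (hopt.1.nonneg s' true u).eq_or_lt with h | h
      · rw [← h, zero_div]
        exact div_nonneg (hopt.1.nonneg _ _ _) (hS s).le
      · have hu := hfalse0 s' u h
        have := hall u h
        rwa [condTS_eq_of_eq_zero (y := true) hu,
          condTS_eq_of_eq_zero (y := true) (hnest u hu)] at this
    · rw [htrue0, zero_div]
      exact div_pos (htrue s t ht) (hS s)
  obtain ⟨v, hv, hvc⟩ : ∃ v, 0 < P s false v ∧ condTS P v s' < condTS P v s := by
    by_contra! hall
    have hfle : pSY P s' false / pS P s' ≤ pSY P s false / pS P s := by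
      linarith [div_pS_add_div_pS (hS s), div_pS_add_div_pS (hS s')]
    refine hfle.not_gt ?_
    rw [← sum_div_pS, ← sum_div_pS]
    refine Finset.sum_lt_sum (fun u _ => ?_) ⟨t, Finset.mem_univ t, ?_⟩
    · rcases (hopt.1.nonneg s false u).eq_or_lt with h | h
      · rw [← h, zero_div]
        exact div_nonneg (hopt.1.nonneg _ _ _) (hS s').le
      · have h0 : ∀ r, P r false u ≠ 0 → P r true u = 0 := fun r hr => by
          by_contra h'
          exact hr (hfalse0 r u ((hopt.1.nonneg _ _ _).lt_of_ne' h'))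
        have := hall u h
        rwa [condTS_eq_of_eq_zero (y := false) (h0 s h.ne'),
          condTS_eq_of_eq_zero (y := false) (h0 s' fun h' => h.ne' (hnest u h'))] at this
    · rw [ht, zero_div]
      exact div_pos hpos' (hS s')
  exact hopt.not_cycle hε hT true hu hv (htrue s t ht) hpos' huc hvc

lemma exists_antitone_enumeration (f : S → ℝ) :
    ∃ e : Fin (Fintype.card S) ≃ S, ∀ i j, i ≤ j → f (e j) ≤ f (e i) := by
  let g : Fin (Fintype.card S) → ℝ := fun i => - f ((Fintype.equivFin S).symm i)
  refine ⟨(Tuple.sort g).trans (Fintype.equivFin S).symm, fun i j hij => ?_⟩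
  exact neg_le_neg_iff.1 (Tuple.monotone_sort g hij)

lemma postYT_le_postYT_iff {P : S → Bool → T → ℝ} {t t' : T} (ht : 0 < pT P t)
    (ht' : 0 < pT P t') : postYT P t' ≤ postYT P t ↔
      pYT P true t' * pYT P false t ≤ pYT P true t * pYT P false t' := by
  have h := pT_eq_add P true t
  have h' := pT_eq_add P true t'
  rw [Bool.not_true] at h h'
  rw [postYT, postYT, div_le_div_iff₀ ht' ht, h, h']
  constructor <;> intro <;> linarith

lemma inTildeT.pYT_pos {P : S → Bool → T → ℝ} (hP : ∀ s y t, 0 ≤ P s y t) {t : T}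
    (h : inTildeT P t) (y : Bool) : 0 < pYT P y t := by
  obtain ⟨hT, h0, h1⟩ := h
  refine (pYT_nonneg hP y t).lt_of_ne' fun hz => ?_
  cases y
  · refine h1 ?_
    rw [postYT, div_eq_one_iff_eq hT.ne', pT_eq_add P true, Bool.not_true, hz, add_zero]
  · exact h0 (by rw [postYT, hz, zero_div])

lemma condTS_le_Hval [Nonempty S] (P : S → Bool → T → ℝ) (t : T) (s : S) :
    condTS P t s ≤ Hval P t :=
  Finset.le_sup' (fun s => condTS P t s) (Finset.mem_univ s)

lemma exists_condTS_eq_Hval [Nonempty S] (P : S → Bool → T → ℝ) (t : T) :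
    ∃ s, condTS P t s = Hval P t := by
  obtain ⟨s, -, hs⟩ := Finset.exists_mem_eq_sup' Finset.univ_nonempty (fun s => condTS P t s)
  exact ⟨s, hs.symm⟩

lemma IsIP.condTS_eq_Hval [Nonempty S] {P : S → Bool → T → ℝ} (h : IsIP 0 P) (t : T) (s : S) :
    condTS P t s = Hval P t := by
  obtain ⟨r, hr⟩ := exists_condTS_eq_Hval P t
  refine (condTS_le_Hval P t s).antisymm ?_
  simpa [hr] using h r s t

/-- A secret with maximal likelihood at a nondegenerate signal has maximal likelihood at every
signal which points further towards its state. -/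
lemma BlackwellOptimal.condTS_eq_Hval [Nonempty S] {ε : ℝ} (hε : 0 ≤ ε) {P : S → Bool → T → ℝ}
    (hopt : BlackwellOptimal ε P) (hT : ∀ t, 0 < pT P t) {t t' : T} (hne : t ≠ t') (y : Bool)
    (hcross : pYT P y t' * pYT P (!y) t ≤ pYT P y t * pYT P (!y) t')
    (hmix : 0 < pYT P (!y) t') {s : S} (h : 0 < P s y t')
    (hH : condTS P t' s = Hval P t') : condTS P t s = Hval P t := by
  rcases hε.eq_or_lt with rfl | hε
  · exact hopt.2.1.condTS_eq_Hval t s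
  · by_contra hlt
    obtain ⟨s₁, hs₁⟩ := hopt.exists_condTS_lt hε hT y h hmix fun r => hH ▸ condTS_le_Hval P t' r
    obtain ⟨s₂, hs₂⟩ := exists_condTS_eq_Hval P t
    exact hopt.not_shift hε.le hT hne y hcross hmix h hs₁
      (hs₂ ▸ (condTS_le_Hval P t s).lt_of_ne hlt)

end Auxiliary

/-- geometric (upper-left / lower-right) characterization of
ε-IP Blackwell optimal information structures. -/
theorem statement2 {S T : Type} [Fintype S] [Fintype T] [Nonempty S] [Nonempty T]
    (ε : ℝ) (hε : 0 ≤ ε) (P : S → Bool → T → ℝ)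
    (hopt : BlackwellOptimal ε P)
    (hpos : ∀ s t, 0 < pST P s t) :
    ∃ (n k : ℕ) (es : Fin n ≃ S) (et : Fin k ≃ T),
      -- enumerations in decreasing order of `P(Y=1|S=s)` resp. `P(Y=1|T=t)`
      (∀ i j : Fin n, i ≤ j → qS P (es j) ≤ qS P (es i)) ∧
      (∀ i j : Fin k, i ≤ j → postYT P (et j) ≤ postYT P (et i)) ∧
      -- (i) the region A is upper-left
      (∀ (i : Fin n) (j : Fin k), postYST P (es i) (et j) = 1 →
        ∀ (i' : Fin n) (j' : Fin k), i' ≤ i → j' ≤ j →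
          postYST P (es i') (et j') = 1) ∧
      -- (ii) the region B is upper-left within the T̃-columns
      (∀ (i : Fin n) (j : Fin k),
        (postYST P (es i) (et j) = 1 ∧ inTildeT P (et j) ∧
          condTS P (et j) (es i) = Hval P (et j)) →
        ∀ (i' : Fin n) (j' : Fin k), i' ≤ i → j' ≤ j → inTildeT P (et j') →
          postYST P (es i') (et j') = 1 ∧
          condTS P (et j') (es i') = Hval P (et j')) ∧
      -- (iii) the region C is lower-right within the T̃-columns
      (∀ (i : Fin n) (j : Fin k),
        (postYST P (es i) (et j) ≠ 1 ∧ inTildeT P (et j) ∧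
          condTS P (et j) (es i) = Hval P (et j)) →
        ∀ (i' : Fin n) (j' : Fin k), i ≤ i' → j ≤ j' → inTildeT P (et j') →
          postYST P (es i') (et j') ≠ 1 ∧
          condTS P (et j') (es i') = Hval P (et j')) := by
  obtain ⟨s₀⟩ := ‹Nonempty S›
  have : Nonempty S := ⟨s₀⟩
  have hP := hopt.1
  have hT : ∀ t, 0 < pT P t := fun t =>
    Finset.sum_pos (fun s _ => hpos s t) Finset.univ_nonempty
  have hzero : ∀ s t, P s true t = 0 ∨ P s false t = 0 := fun s t => by
    by_contra! h
    exact hopt.not_both_pos hε hT (y := true) ((hP.nonneg _ _ _).lt_of_ne' h.1)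
      ((hP.nonneg _ _ _).lt_of_ne' h.2)
  have hpost : ∀ s t, postYST P s t = 1 ↔ P s false t = 0 := fun s t => by
    rw [postYST, div_eq_one_iff_eq (hpos s t).ne', pST_eq_add P s true, Bool.not_true]
    constructor <;> intro h <;> linarith
  have hpost' : ∀ s t, postYST P s t ≠ 1 ↔ P s true t = 0 := fun s t => by
    rw [Ne, hpost]
    refine ⟨fun h => (hzero s t).resolve_right h, fun h h' => (hpos s t).ne' ?_⟩
    rw [pST_eq_add P s true, Bool.not_true, h, h', add_zero]
  have htrue : ∀ s t, P s false t = 0 → 0 < P s true t := fun s t h =>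
    (hP.nonneg _ _ _).lt_of_ne' fun h' => (hpost' s t).2 h' ((hpost s t).2 h)
  have hfalse : ∀ s t, P s true t = 0 → 0 < P s false t := fun s t h =>
    (hP.nonneg _ _ _).lt_of_ne' fun h' => (hpost' s t).2 h ((hpost s t).2 h')
  have hrow : ∀ t t', postYT P t' ≤ postYT P t → ∀ s, P s true t' ≠ 0 → t ≠ t' →
      P s false t = 0 := fun t t' hle s h hne => by
    by_contra h'
    exact hopt.not_swap hε hT hne ((postYT_le_postYT_iff (hT t) (hT t')).1 hle)
      ((hP.nonneg _ _ _).lt_of_ne' h') ((hP.nonneg _ _ _).lt_of_ne' h)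
  have hcol : ∀ s s' t, qS P s ≤ qS P s' → P s false t = 0 → P s' false t = 0 :=
    fun s s' t hle ht => hopt.eq_zero_of_qS_le hε hpos hT hrow hle ht
  have hcol' : ∀ s s' t, qS P s' ≤ qS P s → P s true t = 0 → P s' true t = 0 :=
    fun s s' t hle ht => (hzero s' t).resolve_right fun h =>
      (hfalse s t ht).ne' (hcol s' s t hle h)
  obtain ⟨es, hes⟩ := exists_antitone_enumeration (qS P)
  obtain ⟨et, het⟩ := exists_antitone_enumeration (postYT P)
  have hA : ∀ i j, postYST P (es i) (et j) = 1 → ∀ i' j', i' ≤ i → j' ≤ j →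
      postYST P (es i') (et j') = 1 := by
    intro i j h i' j' hi hj
    rw [hpost] at h ⊢
    have h1 := hcol _ _ _ (hes i' i hi) h
    rcases eq_or_ne j' j with rfl | hne
    · exact h1
    · exact hrow _ _ (het j' j hj) _ (htrue _ _ h1).ne' (et.injective.ne hne)
  refine ⟨_, _, es, et, hes, het, hA, ?_, ?_⟩
  · rintro i j ⟨h, htil, hH⟩ i' j' hi hj -
    refine ⟨hA i j h i' j' hi hj, ?_⟩
    have h1 := (hpost _ _).1 (hA i j h i' j hi le_rfl)
    have hH' : condTS P (et j) (es i') = Hval P (et j) := by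
      refine (condTS_le_Hval P _ _).antisymm (hH ▸ ?_)
      exact hopt.condTS_le_condTS hε hpos hT true (hes i' i hi)
        (fun t => hcol _ _ t (hes i' i hi)) (htil.pYT_pos hP.1 false) ((hpost _ _).1 h)
    rcases eq_or_ne j' j with rfl | hne
    · exact hH'
    · exact hopt.condTS_eq_Hval hε hT (et.injective.ne hne) true
        ((postYT_le_postYT_iff (hT _) (hT _)).1 (het j' j hj)) (htil.pYT_pos hP.1 false)
        (htrue _ _ h1) hH'
  · rintro i j ⟨h, htil, hH⟩ i' j' hi hj -
    refine ⟨fun h' => h (hA i' j' h' i j hi hj), ?_⟩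
    have h1 := (hpost' _ _).1 fun h' => h (hA i' j h' i j hi le_rfl)
    have hq : pSY P (es i) false / pS P (es i) ≤ pSY P (es i') false / pS P (es i') := by
      have hle : pSY P (es i') true / pS P (es i') ≤ pSY P (es i) true / pS P (es i) :=
        hes i i' hi
      linarith [div_pS_add_div_pS (hP.2.2 (es i)), div_pS_add_div_pS (hP.2.2 (es i'))]
    have hH' : condTS P (et j) (es i') = Hval P (et j) := by
      refine (condTS_le_Hval P _ _).antisymm (hH ▸ ?_)
      exact hopt.condTS_le_condTS hε hpos hT false hq
        (fun t => hcol' _ _ t (hes i i' hi)) (htil.pYT_pos hP.1 true) ((hpost' _ _).1 h)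
    rcases eq_or_ne j' j with rfl | hne
    · exact hH'
    · refine hopt.condTS_eq_Hval hε hT (et.injective.ne hne) false ?_ (htil.pYT_pos hP.1 true)
        (hfalse _ _ h1) hH'
      have := (postYT_le_postYT_iff (hT _) (hT _)).1 (het j j' hj)
      rw [Bool.not_false]
      linarith

end IPPaper
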